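/- Let S be a ℂ-linear subspace of the d×d complex matrices, and define the non-commutative rank ncrk(S) := d − max_{U ≤ ℂ^d} (dim U − dim S(U)), where the maximum ranges over all ℂ-linear subspaces U of ℂ^d. Then mrk(S) ≤ ncrk(S) ≤ 2·mrk(S). -/

import Mathlib

open Matrix

noncomputable def mrk {m n : Type*} [Fintype m] [Fintype n]
    (S : Submodule ℂ (Matrix m n ℂ)) : ℕ :=
  sSup (Matrix.rank '' (S : Set (Matrix m n ℂ)))

noncomputable def tensorSpace {m₁ n₁ m₂ n₂ : Type*}
    (S : Submodule ℂ (Matrix m₁ n₁ ℂ)) (T : Submodule ℂ (Matrix m₂ n₂ ℂ)) :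
    Submodule ℂ (Matrix (m₁ × m₂) (n₁ × n₂) ℂ) :=
  Submodule.span ℂ {M | ∃ A ∈ S, ∃ B ∈ T, M = Matrix.kroneckerMap (· * ·) A B}

noncomputable def tensorPow {d : ℕ} (S : Submodule ℂ (Matrix (Fin d) (Fin d) ℂ)) (n : ℕ) :
    Submodule ℂ (Matrix (Fin n → Fin d) (Fin n → Fin d) ℂ) :=
  Submodule.span ℂ {M | ∃ A : Fin n → Matrix (Fin d) (Fin d) ℂ,
    (∀ k, A k ∈ S) ∧ M = fun i j => ∏ k, A k (i k) (j k)}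

noncomputable def spaceImageOf {ι κ : Type*} [Fintype κ]
    (S : Submodule ℂ (Matrix ι κ ℂ)) (U : Submodule ℂ (κ → ℂ)) : Submodule ℂ (ι → ℂ) :=
  Submodule.span ℂ {v | ∃ A ∈ S, ∃ u ∈ U, v = A.mulVec u}

def HasShrunkSubspace {ι : Type*} [Fintype ι]
    (S : Submodule ℂ (Matrix ι ι ℂ)) : Prop :=
  ∃ U : Submodule ℂ (ι → ℂ),
    Module.finrank ℂ (spaceImageOf S U) < Module.finrank ℂ U

noncomputable def compSpace (p q m n : ℕ) : Submodule ℂ (Matrix (Fin m) (Fin n) ℂ) where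
  carrier := {A | ∀ (i : Fin m) (j : Fin n), p ≤ (i : ℕ) → q ≤ (j : ℕ) → A i j = 0}
  add_mem' := by
    intro a b ha hb i j hi hj
    simp only [Matrix.add_apply, ha i j hi hj, hb i j hi hj, add_zero]
  zero_mem' := by intro i j _ _; rfl
  smul_mem' := by
    intro c a ha i j hi hj
    simp only [Matrix.smul_apply, ha i j hi hj, smul_zero]

noncomputable def ncrk {d : ℕ} (S : Submodule ℂ (Matrix (Fin d) (Fin d) ℂ)) : ℕ :=
  d - sSup {k : ℕ | ∃ U : Submodule ℂ (Fin d → ℂ),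
    k = Module.finrank ℂ U - Module.finrank ℂ (spaceImageOf S U)}

open Filter Topology in
/-- A matrix of maximal rank in a pencil `A + t B` has the property that `B` maps the kernel of `A`
into the range of `A`. -/
theorem Matrix.mulVec_mem_range_of_rank_add_smul_le {m n : Type*} [Fintype m] [Fintype n]
    {A B : Matrix m n ℂ} (h : ∀ t : ℂ, (A + t • B).rank ≤ A.rank)
    {x : n → ℂ} (hx : A *ᵥ x = 0) : B *ᵥ x ∈ LinearMap.range A.mulVecLin := by
  by_contra hB
  let b := Module.finBasis ℂ (LinearMap.range A.mulVecLin)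
  choose v hv using fun i => LinearMap.mem_range.mp (b i).2
  simp only [Matrix.mulVecLin_apply] at hv
  let w : ℂ → Fin (A.rank + 1) → m → ℂ :=
    fun t => Fin.cons (B *ᵥ x) fun i => (A + t • B) *ᵥ v i
  have hw : Continuous w := by
    refine continuous_pi fun i => ?_
    refine Fin.cases ?_ (fun j => ?_) i
    · simpa [w] using continuous_const
    · simp only [w, Fin.cons_succ, Matrix.add_mulVec, Matrix.smul_mulVec]
      fun_prop
  have hli : LinearIndependent ℂ (w 0) := by
    have hb : LinearIndependent ℂ fun i => (A + (0 : ℂ) • B) *ᵥ v i := by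
      have := b.linearIndependent.map' (LinearMap.range A.mulVecLin).subtype
        (Submodule.ker_subtype _)
      have heq : (fun i => (A + (0 : ℂ) • B) *ᵥ v i) =
          (LinearMap.range A.mulVecLin).subtype ∘ b := by
        ext1 i
        simp [hv]
      rw [heq]
      exact this
    refine linearIndependent_finCons.mpr ⟨hb, fun hmem => hB ?_⟩
    refine Submodule.span_le.mpr ?_ hmem
    rintro _ ⟨i, rfl⟩
    exact ⟨v i, by simp⟩
  have hev : ∀ᶠ t in 𝓝[≠] (0 : ℂ), LinearIndependent ℂ (w t) :=
    (hw.continuousAt.eventually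
      (isOpen_setOfPred_linearIndependent.mem_nhds hli)).filter_mono nhdsWithin_le_nhds
  obtain ⟨t, ht, ht0⟩ := (hev.and self_mem_nhdsWithin).exists
  have hsub : Submodule.span ℂ (Set.range (w t)) ≤ LinearMap.range (A + t • B).mulVecLin := by
    rw [Submodule.span_le]
    rintro _ ⟨i, rfl⟩
    refine Fin.cases ?_ (fun j => ?_) i
    · refine ⟨t⁻¹ • x, ?_⟩
      simp [w, Matrix.add_mulVec, Matrix.smul_mulVec, hx,
        inv_mul_cancel₀ (show t ≠ 0 from ht0), smul_smul]
    · exact ⟨v j, rfl⟩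
  have hcard := finrank_span_eq_card ht
  have hle := Submodule.finrank_mono hsub
  have := h t
  rw [hcard, Fintype.card_fin] at hle
  exact absurd (hle.trans this) (by simp)

theorem bddAbove_rank_image {m n : Type*} [Fintype m] [Fintype n]
    (S : Set (Matrix m n ℂ)) : BddAbove (Matrix.rank '' S) :=
  ⟨Fintype.card n, by rintro _ ⟨A, -, rfl⟩; exact A.rank_le_card_width⟩

theorem rank_le_mrk {m n : Type*} [Fintype m] [Fintype n]
    {S : Submodule ℂ (Matrix m n ℂ)} {A : Matrix m n ℂ} (hA : A ∈ S) : A.rank ≤ mrk S :=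
  le_csSup (bddAbove_rank_image _) ⟨A, hA, rfl⟩

theorem exists_rank_eq_mrk {m n : Type*} [Fintype m] [Fintype n]
    (S : Submodule ℂ (Matrix m n ℂ)) : ∃ A ∈ S, A.rank = mrk S :=
  Nat.sSup_mem (Set.Nonempty.image _ ⟨0, S.zero_mem⟩) (bddAbove_rank_image _)

theorem Matrix.rank_add_finrank_ker_mulVecLin {m n : Type*} [Fintype m] [Fintype n]
    (A : Matrix m n ℂ) :
    A.rank + Module.finrank ℂ (LinearMap.ker A.mulVecLin) = Fintype.card n := by
  rw [← Module.finrank_fintype_fun_eq_card (R := ℂ)]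
  exact A.mulVecLin.finrank_range_add_finrank_ker

theorem finrank_add_rank_le {m n : Type*} [Fintype m] [Fintype n]
    {S : Submodule ℂ (Matrix m n ℂ)} {A : Matrix m n ℂ} (hA : A ∈ S)
    (U : Submodule ℂ (n → ℂ)) :
    Module.finrank ℂ U + A.rank ≤ Module.finrank ℂ (spaceImageOf S U) + Fintype.card n := by
  have hmap : U.map A.mulVecLin ≤ spaceImageOf S U := by
    rintro _ ⟨u, hu, rfl⟩
    exact Submodule.subset_span ⟨A, hA, u, hu, rfl⟩
  have himage := Submodule.finrank_mono hmap
  have hrn := (A.mulVecLin.domRestrict U).finrank_range_add_finrank_ker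
  rw [LinearMap.range_domRestrict] at hrn
  have hker : Module.finrank ℂ (LinearMap.ker (A.mulVecLin.domRestrict U)) ≤
      Module.finrank ℂ (LinearMap.ker A.mulVecLin) := by
    rw [LinearMap.ker_domRestrict, (Submodule.equivMapOfInjective U.subtype
      U.injective_subtype _).finrank_eq]
    exact Submodule.finrank_mono (Submodule.map_comap_le _ _)
  have := A.rank_add_finrank_ker_mulVecLin
  omega

theorem finrank_spaceImageOf_ker_le {m n : Type*} [Fintype m] [Fintype n]
    {S : Submodule ℂ (Matrix m n ℂ)} {A : Matrix m n ℂ} (hA : A ∈ S) (hr : A.rank = mrk S) :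
    Module.finrank ℂ (spaceImageOf S (LinearMap.ker A.mulVecLin)) ≤ A.rank := by
  refine Submodule.finrank_mono (Submodule.span_le.mpr ?_)
  rintro _ ⟨B, hB, u, hu, rfl⟩
  refine Matrix.mulVec_mem_range_of_rank_add_smul_le (fun t => ?_) hu
  exact hr ▸ rank_le_mrk (S.add_mem hA (S.smul_mem t hB))

theorem stmt11 {d : ℕ} (S : Submodule ℂ (Matrix (Fin d) (Fin d) ℂ)) :
    mrk S ≤ ncrk S ∧ ncrk S ≤ 2 * mrk S := by
  obtain ⟨A, hA, hr⟩ := exists_rank_eq_mrk S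
  have hcard : A.rank + Module.finrank ℂ (LinearMap.ker A.mulVecLin) = d := by
    simpa using A.rank_add_finrank_ker_mulVecLin
  unfold ncrk
  set K := {k : ℕ | ∃ U : Submodule ℂ (Fin d → ℂ),
    k = Module.finrank ℂ U - Module.finrank ℂ (spaceImageOf S U)}
  have hub : ∀ k ∈ K, k ≤ d - A.rank := by
    rintro _ ⟨U, rfl⟩
    have := finrank_add_rank_le hA U
    rw [Fintype.card_fin] at this
    omega
  have hmem : Module.finrank ℂ (LinearMap.ker A.mulVecLin) -
      Module.finrank ℂ (spaceImageOf S (LinearMap.ker A.mulVecLin)) ∈ K := ⟨_, rfl⟩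
  constructor
  · have := csSup_le ⟨_, hmem⟩ hub
    omega
  · have := le_csSup ⟨_, hub⟩ hmem
    have := finrank_spaceImageOf_ker_le hA hr
    omega
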